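/- arXiv:2210.00116 — 4 statements merged into one kernel-verified Lean document; each statement's English description precedes it below -/
import Mathlib

section
/- For every value tuple (g, x, t, t', y, y') such that all conditioning events below have positive probability, the following evidence lower bound holds: log p(y' | y, g, x, t, t') + log p(y | g, x, t) ≥ Σ_z p(z | y, g, x, t) · log p_O(y | z, t) + log p(y' | g, x, t') − KL[ p(· | y, g, x, t) ∥ p(· | y', g, x, t') ], where KL[q₁ ∥ q₂] = Σ_z q₁(z) · log( q₁(z) / q₂(z) ) is the Kullback–Leibler divergence between the two conditional pmfs of Z, and p(y' | y, g, x, t, t') denotes the conditional pmf of the counterfactual outcome Y' given (Y, G, X, T, T'). -/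
/-- Tuple of values `(g, x, z, t, t', y, y')` for the causal model of Figure 1. -/
structure Tup (𝒢 𝒳 𝒵 𝒯 𝒴 : Type*) where
  g : 𝒢
  x : 𝒳
  z : 𝒵
  t : 𝒯
  t' : 𝒯
  y : 𝒴
  y' : 𝒴

instance {𝒢 𝒳 𝒵 𝒯 𝒴 : Type*} [Fintype 𝒢] [Fintype 𝒳] [Fintype 𝒵] [Fintype 𝒯] [Fintype 𝒴] :
    Fintype (Tup 𝒢 𝒳 𝒵 𝒯 𝒴) :=
  Fintype.ofEquiv (𝒢 × 𝒳 × 𝒵 × 𝒯 × 𝒯 × 𝒴 × 𝒴)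
    { toFun := fun p => ⟨p.1, p.2.1, p.2.2.1, p.2.2.2.1, p.2.2.2.2.1, p.2.2.2.2.2.1, p.2.2.2.2.2.2⟩
      invFun := fun d => (d.g, d.x, d.z, d.t, d.t', d.y, d.y')
      left_inv := fun _ => rfl
      right_inv := fun _ => rfl }

/-- Probability of an event under a pmf `p` on a finite type. -/
noncomputable def Pr {D : Type*} [Fintype D] (p : D → ℝ) (E : Set D) : ℝ :=
  ∑ d, E.indicator p d

/-- Conditional probability `p(A | B)`, defined as a ratio of marginal sums of `p`. -/
noncomputable def condPr {D : Type*} [Fintype D] (p : D → ℝ) (A B : Set D) : ℝ :=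
  Pr p (A ∩ B) / Pr p B

/-- The joint pmf factorizing along the Bayesian network of Figure 1. -/
noncomputable def joint {𝒢 𝒳 𝒵 𝒯 𝒴 : Type*} (pG : 𝒢 → ℝ) (pX : 𝒳 → ℝ)
    (pT pT' : 𝒯 → 𝒳 → ℝ) (pZ : 𝒵 → 𝒢 → 𝒳 → ℝ) (pO : 𝒴 → 𝒵 → 𝒯 → ℝ)
    (d : Tup 𝒢 𝒳 𝒵 𝒯 𝒴) : ℝ :=
  pG d.g * pX d.x * pT d.t d.x * pT' d.t' d.x * pZ d.z d.g d.x * pO d.y d.z d.t * pO d.y' d.z d.t'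

theorem Pr_box {𝒢 𝒳 𝒵 𝒯 𝒴 : Type*} [Fintype 𝒢] [Fintype 𝒳] [Fintype 𝒵] [Fintype 𝒯] [Fintype 𝒴]
    (pG : 𝒢 → ℝ) (pX : 𝒳 → ℝ) (pT pT' : 𝒯 → 𝒳 → ℝ)
    (pZ : 𝒵 → 𝒢 → 𝒳 → ℝ) (pO : 𝒴 → 𝒵 → 𝒯 → ℝ)
    (p : Tup 𝒢 𝒳 𝒵 𝒯 𝒴 → ℝ)
    (hp : ∀ d, p d = joint pG pX pT pT' pZ pO d) (g : 𝒢) (x : 𝒳)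
    (SZ : Finset 𝒵) (ST ST' : Finset 𝒯) (SY SY' : Finset 𝒴) (E : Set (Tup 𝒢 𝒳 𝒵 𝒯 𝒴))
    (hE : ∀ d, d ∈ E ↔ d.g = g ∧ d.x = x ∧ d.z ∈ SZ ∧ d.t ∈ ST ∧ d.t' ∈ ST' ∧ d.y ∈ SY ∧
      d.y' ∈ SY') :
    Pr p E = pG g * pX x * ∑ z ∈ SZ, pZ z g x * (∑ t ∈ ST, pT t x * ∑ y ∈ SY, pO y z t) *
      (∑ t' ∈ ST', pT' t' x * ∑ y' ∈ SY', pO y' z t') := by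
  classical
  have h1 : Pr p E = ∑ q ∈ SZ ×ˢ (ST ×ˢ SY) ×ˢ (ST' ×ˢ SY'),
      p ⟨g, x, q.1, q.2.1.1, q.2.2.1, q.2.1.2, q.2.2.2⟩ := by
    unfold Pr
    simp only [Set.indicator_apply]
    rw [← Finset.sum_filter]
    refine Finset.sum_nbij' (fun d => (d.z, (d.t, d.y), (d.t', d.y')))
      (fun q => ⟨g, x, q.1, q.2.1.1, q.2.2.1, q.2.1.2, q.2.2.2⟩) ?_ ?_ ?_ ?_ ?_
    · intro d hd
      simp [hE] at hd ⊢
      tauto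
    · intro q hq
      simp [hE] at hq ⊢
      tauto
    · rintro ⟨⟩ hd
      simp [hE] at hd ⊢
      simp [hd.1, hd.2.1]
    · intro q hq
      rfl
    · rintro ⟨⟩ hd
      simp [hE] at hd ⊢
      simp [hd.1, hd.2.1]
  rw [h1]
  have h2 : ∀ z, pZ z g x * (∑ t ∈ ST, pT t x * ∑ y ∈ SY, pO y z t) *
      (∑ t' ∈ ST', pT' t' x * ∑ y' ∈ SY', pO y' z t') =
      pZ z g x * ∑ q ∈ (ST ×ˢ SY) ×ˢ (ST' ×ˢ SY'),
        (pT q.1.1 x * pO q.1.2 z q.1.1) * (pT' q.2.1 x * pO q.2.2 z q.2.1) := by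
    intro z
    rw [mul_assoc, Finset.sum_product (s := ST ×ˢ SY)]
    dsimp only
    rw [← Finset.sum_mul_sum, Finset.sum_product, Finset.sum_product]
    simp only [Finset.mul_sum]
  rw [Finset.sum_product]
  simp only [h2]
  simp only [Finset.mul_sum, hp, joint]
  refine Finset.sum_congr rfl fun z _ => Finset.sum_congr rfl fun q _ => ?_
  ring

theorem jensen_aux {𝒵 : Type*} [Fintype 𝒵] [Nonempty 𝒵] (w a b : 𝒵 → ℝ) (hw : ∀ z, 0 < w z)
    (ha : ∀ z, 0 < a z) (hb : ∀ z, 0 < b z) :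
    Real.log ((∑ z, w z * a z * b z) / ∑ z, w z * a z) + Real.log (∑ z, w z * a z) ≥
      (∑ z, (w z * a z / ∑ z, w z * a z) * Real.log (a z)) + Real.log (∑ z, w z * b z) -
      ∑ z, (w z * a z / ∑ z, w z * a z) * Real.log ((w z * a z / ∑ z, w z * a z) /
        (w z * b z / ∑ z, w z * b z)) := by
  have hA : 0 < ∑ z, w z * a z :=
    Finset.sum_pos (fun z _ => mul_pos (hw z) (ha z)) Finset.univ_nonempty
  have hB : 0 < ∑ z, w z * b z :=
    Finset.sum_pos (fun z _ => mul_pos (hw z) (hb z)) Finset.univ_nonempty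
  have hC : 0 < ∑ z, w z * a z * b z :=
    Finset.sum_pos (fun z _ => mul_pos (mul_pos (hw z) (ha z)) (hb z)) Finset.univ_nonempty
  set A := ∑ z, w z * a z with hAd
  set B := ∑ z, w z * b z with hBd
  have hq : ∑ z, w z * a z / A = 1 := by
    rw [← Finset.sum_div, ← hAd, div_self hA.ne']
  have hJ := strictConcaveOn_log_Ioi.concaveOn.le_map_sum (t := Finset.univ)
    (w := fun z => w z * a z / A) (p := fun z => A * b z)
    (fun z _ => (div_pos (mul_pos (hw z) (ha z)) hA).le) hq
    (fun z _ => mul_pos hA (hb z))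
  simp only [smul_eq_mul] at hJ
  have e1 : ∑ z, w z * a z / A * (A * b z) = ∑ z, w z * a z * b z := by
    refine Finset.sum_congr rfl fun z _ => ?_
    field_simp
  rw [e1] at hJ
  rw [Real.log_div hC.ne' hA.ne', sub_add_cancel, ge_iff_le]
  refine le_trans (le_of_eq ?_) hJ
  have e2 : Real.log B = ∑ z, w z * a z / A * Real.log B := by
    rw [← Finset.sum_mul, hq, one_mul]
  rw [e2, ← Finset.sum_add_distrib, ← Finset.sum_sub_distrib]
  refine Finset.sum_congr rfl fun z _ => ?_
  have := hw z
  have := ha z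
  have := hb z
  rw [Real.log_div (by positivity) (by positivity), Real.log_div (by positivity) (by positivity),
    Real.log_div (by positivity) (by positivity), Real.log_mul (by positivity) (by positivity),
    Real.log_mul (by positivity) (by positivity), Real.log_mul (by positivity) (by positivity)]
  ring

/-- **Theorem 2.1 (ELBO).** For every value tuple `(g, x, t, t', y, y')`, the objective
`log p(y' | y, g, x, t, t') + log p(y | g, x, t)` is bounded below by the evidence lower bound
`E_{p(z | y, g, x, t)} log p_O(y | z, t) + log p(y' | g, x, t')
  - KL[p(· | y, g, x, t) ∥ p(· | y', g, x, t')]`. -/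
theorem elbo_of_graph_variational_causal_inference
    {𝒢 𝒳 𝒵 𝒯 𝒴 : Type*} [Fintype 𝒢] [Fintype 𝒳] [Fintype 𝒵] [Fintype 𝒯] [Fintype 𝒴]
    [Nonempty 𝒢] [Nonempty 𝒳] [Nonempty 𝒵] [Nonempty 𝒯] [Nonempty 𝒴]
    (pG : 𝒢 → ℝ) (pX : 𝒳 → ℝ) (pT pT' : 𝒯 → 𝒳 → ℝ)
    (pZ : 𝒵 → 𝒢 → 𝒳 → ℝ) (pO : 𝒴 → 𝒵 → 𝒯 → ℝ)
    (p : Tup 𝒢 𝒳 𝒵 𝒯 𝒴 → ℝ)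
    (hp : ∀ d, p d = joint pG pX pT pT' pZ pO d)
    (hpG0 : ∀ g, 0 ≤ pG g) (hpG1 : ∑ g, pG g = 1)
    (hpX0 : ∀ x, 0 ≤ pX x) (hpX1 : ∑ x, pX x = 1)
    (hpT0 : ∀ t x, 0 ≤ pT t x) (hpT1 : ∀ x, ∑ t, pT t x = 1)
    (hpT'0 : ∀ t x, 0 ≤ pT' t x) (hpT'1 : ∀ x, ∑ t, pT' t x = 1)
    (hpZ0 : ∀ z g x, 0 ≤ pZ z g x) (hpZ1 : ∀ g x, ∑ z, pZ z g x = 1)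
    (hpO0 : ∀ y z t, 0 ≤ pO y z t) (hpO1 : ∀ z t, ∑ y, pO y z t = 1)
    (hpos : ∀ d, 0 < p d)
    (g : 𝒢) (x : 𝒳) (t t' : 𝒯) (y y' : 𝒴) :
    Real.log (condPr p {d | d.y' = y'}
        {d | d.y = y ∧ d.g = g ∧ d.x = x ∧ d.t = t ∧ d.t' = t'})
      + Real.log (condPr p {d | d.y = y} {d | d.g = g ∧ d.x = x ∧ d.t = t}) ≥
    (∑ z, condPr p {d | d.z = z} {d | d.y = y ∧ d.g = g ∧ d.x = x ∧ d.t = t}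
        * Real.log (pO y z t))
      + Real.log (condPr p {d | d.y' = y'} {d | d.g = g ∧ d.x = x ∧ d.t' = t'})
      - ∑ z, condPr p {d | d.z = z} {d | d.y = y ∧ d.g = g ∧ d.x = x ∧ d.t = t}
          * Real.log (condPr p {d | d.z = z} {d | d.y = y ∧ d.g = g ∧ d.x = x ∧ d.t = t}
            / condPr p {d | d.z = z} {d | d.y' = y' ∧ d.g = g ∧ d.x = x ∧ d.t' = t'}) := by
  have hall : ∀ z, 0 < pG g ∧ 0 < pX x ∧ 0 < pT t x ∧ 0 < pT' t' x ∧ 0 < pZ z g x ∧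
      0 < pO y z t ∧ 0 < pO y' z t' := by
    intro z
    have h := hpos ⟨g, x, z, t, t', y, y'⟩
    rw [hp] at h
    simp only [joint] at h
    refine ⟨(hpG0 g).lt_of_ne' ?_, (hpX0 x).lt_of_ne' ?_, (hpT0 t x).lt_of_ne' ?_,
      (hpT'0 t' x).lt_of_ne' ?_, (hpZ0 z g x).lt_of_ne' ?_, (hpO0 y z t).lt_of_ne' ?_,
      (hpO0 y' z t').lt_of_ne' ?_⟩ <;>
    · intro h0
      simp [h0] at h
  obtain ⟨z0⟩ := (inferInstance : Nonempty 𝒵)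
  obtain ⟨kG, kX, kT, kT', -⟩ := hall z0
  haveI : Nonempty 𝒵 := ⟨z0⟩
  have h1 : Pr p ({d | d.y' = y'} ∩ {d | d.y = y ∧ d.g = g ∧ d.x = x ∧ d.t = t ∧ d.t' = t'}) = (pG g * pX x * pT t x * pT' t' x) * ∑ z, pZ z g x * pO y z t * pO y' z t' := by
    rw [Pr_box pG pX pT pT' pZ pO p hp g x Finset.univ {t} {t'} {y} {y'} _ (by
      intro d
      simp only [Set.mem_inter_iff, Set.mem_setOf_eq, Finset.mem_univ, Finset.mem_singleton]
      tauto)]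
    simp only [Finset.sum_singleton, hpO1, hpT1, hpT'1, mul_one]
    rw [Finset.mul_sum, Finset.mul_sum]
    exact Finset.sum_congr rfl fun z _ => by ring
  have h2 : Pr p ({d | d.y = y ∧ d.g = g ∧ d.x = x ∧ d.t = t ∧ d.t' = t'}) = (pG g * pX x * pT t x * pT' t' x) * ∑ z, pZ z g x * pO y z t := by
    rw [Pr_box pG pX pT pT' pZ pO p hp g x Finset.univ {t} {t'} {y} Finset.univ _ (by
      intro d
      simp only [Set.mem_inter_iff, Set.mem_setOf_eq, Finset.mem_univ, Finset.mem_singleton]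
      tauto)]
    simp only [Finset.sum_singleton, hpO1, hpT1, hpT'1, mul_one]
    rw [Finset.mul_sum, Finset.mul_sum]
    exact Finset.sum_congr rfl fun z _ => by ring
  have h3 : Pr p ({d | d.y = y} ∩ {d | d.g = g ∧ d.x = x ∧ d.t = t}) = (pG g * pX x * pT t x) * ∑ z, pZ z g x * pO y z t := by
    rw [Pr_box pG pX pT pT' pZ pO p hp g x Finset.univ {t} Finset.univ {y} Finset.univ _ (by
      intro d
      simp only [Set.mem_inter_iff, Set.mem_setOf_eq, Finset.mem_univ, Finset.mem_singleton]
      tauto)]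
    simp only [Finset.sum_singleton, hpO1, hpT1, hpT'1, mul_one]
    rw [Finset.mul_sum, Finset.mul_sum]
    exact Finset.sum_congr rfl fun z _ => by ring
  have h4 : Pr p ({d | d.g = g ∧ d.x = x ∧ d.t = t}) = (pG g * pX x * pT t x) := by
    rw [Pr_box pG pX pT pT' pZ pO p hp g x Finset.univ {t} Finset.univ Finset.univ Finset.univ _ (by
      intro d
      simp only [Set.mem_inter_iff, Set.mem_setOf_eq, Finset.mem_univ, Finset.mem_singleton]
      tauto)]
    simp only [Finset.sum_singleton, hpO1, hpT1, hpT'1, mul_one]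
    rw [← Finset.sum_mul, hpZ1]
    ring
  have h5 : Pr p ({d | d.y = y ∧ d.g = g ∧ d.x = x ∧ d.t = t}) = (pG g * pX x * pT t x) * ∑ z, pZ z g x * pO y z t := by
    rw [Pr_box pG pX pT pT' pZ pO p hp g x Finset.univ {t} Finset.univ {y} Finset.univ _ (by
      intro d
      simp only [Set.mem_inter_iff, Set.mem_setOf_eq, Finset.mem_univ, Finset.mem_singleton]
      tauto)]
    simp only [Finset.sum_singleton, hpO1, hpT1, hpT'1, mul_one]
    rw [Finset.mul_sum, Finset.mul_sum]
    exact Finset.sum_congr rfl fun z _ => by ring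
  have h7 : Pr p ({d | d.y' = y'} ∩ {d | d.g = g ∧ d.x = x ∧ d.t' = t'}) = (pG g * pX x * pT' t' x) * ∑ z, pZ z g x * pO y' z t' := by
    rw [Pr_box pG pX pT pT' pZ pO p hp g x Finset.univ Finset.univ {t'} Finset.univ {y'} _ (by
      intro d
      simp only [Set.mem_inter_iff, Set.mem_setOf_eq, Finset.mem_univ, Finset.mem_singleton]
      tauto)]
    simp only [Finset.sum_singleton, hpO1, hpT1, hpT'1, mul_one]
    rw [Finset.mul_sum, Finset.mul_sum]
    exact Finset.sum_congr rfl fun z _ => by ring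
  have h8 : Pr p ({d | d.g = g ∧ d.x = x ∧ d.t' = t'}) = (pG g * pX x * pT' t' x) := by
    rw [Pr_box pG pX pT pT' pZ pO p hp g x Finset.univ Finset.univ {t'} Finset.univ Finset.univ _ (by
      intro d
      simp only [Set.mem_inter_iff, Set.mem_setOf_eq, Finset.mem_univ, Finset.mem_singleton]
      tauto)]
    simp only [Finset.sum_singleton, hpO1, hpT1, hpT'1, mul_one]
    rw [← Finset.sum_mul, hpZ1]
    ring
  have h9 : Pr p ({d | d.y' = y' ∧ d.g = g ∧ d.x = x ∧ d.t' = t'}) = (pG g * pX x * pT' t' x) * ∑ z, pZ z g x * pO y' z t' := by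
    rw [Pr_box pG pX pT pT' pZ pO p hp g x Finset.univ Finset.univ {t'} Finset.univ {y'} _ (by
      intro d
      simp only [Set.mem_inter_iff, Set.mem_setOf_eq, Finset.mem_univ, Finset.mem_singleton]
      tauto)]
    simp only [Finset.sum_singleton, hpO1, hpT1, hpT'1, mul_one]
    rw [Finset.mul_sum, Finset.mul_sum]
    exact Finset.sum_congr rfl fun z _ => by ring
  have h6 : ∀ z, Pr p ({d | d.z = z} ∩ {d | d.y = y ∧ d.g = g ∧ d.x = x ∧ d.t = t}) = (pG g * pX x * pT t x) * (pZ z g x * pO y z t) := by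
    intro z
    rw [Pr_box pG pX pT pT' pZ pO p hp g x {z} {t} Finset.univ {y} Finset.univ _ (by
      intro d
      simp only [Set.mem_inter_iff, Set.mem_setOf_eq, Finset.mem_univ, Finset.mem_singleton]
      tauto)]
    simp only [Finset.sum_singleton, hpO1, hpT1, hpT'1, mul_one]
    ring
  have h10 : ∀ z, Pr p ({d | d.z = z} ∩ {d | d.y' = y' ∧ d.g = g ∧ d.x = x ∧ d.t' = t'}) = (pG g * pX x * pT' t' x) * (pZ z g x * pO y' z t') := by
    intro z
    rw [Pr_box pG pX pT pT' pZ pO p hp g x {z} Finset.univ {t'} Finset.univ {y'} _ (by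
      intro d
      simp only [Set.mem_inter_iff, Set.mem_setOf_eq, Finset.mem_univ, Finset.mem_singleton]
      tauto)]
    simp only [Finset.sum_singleton, hpO1, hpT1, hpT'1, mul_one]
    ring
  have k : (pG g * pX x * pT t x) ≠ 0 := by positivity
  have k2 : (pG g * pX x * pT' t' x) ≠ 0 := by positivity
  have k3 : (pG g * pX x * pT t x * pT' t' x) ≠ 0 := by positivity
  simp only [condPr, h1, h2, h3, h4, h5, h6, h7, h8, h9, h10, mul_div_mul_left _ _ k,
    mul_div_mul_left _ _ k2, mul_div_mul_left _ _ k3, mul_div_cancel_left₀ _ k,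
    mul_div_cancel_left₀ _ k2]
  exact jensen_aux (fun z => pZ z g x) (fun z => pO y z t) (fun z => pO y' z t')
    (fun z => (hall z).2.2.2.2.1) (fun z => (hall z).2.2.2.2.2.1) (fun z => (hall z).2.2.2.2.2.2)
end

section
/- For all values z, y, g, x, t, t' (with the conditioning events having positive probability), p(z | y, g, x, t, t') = p(z | y, g, x, t); that is, given the factual outcome Y, graph G, covariates X and factual treatment T, the latent Z is conditionally independent of the counterfactual treatment T'. -/
theorem sum_Tup {𝒢 𝒳 𝒵 𝒯 𝒴 : Type*} [Fintype 𝒢] [Fintype 𝒳] [Fintype 𝒵] [Fintype 𝒯] [Fintype 𝒴]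
    (f : Tup 𝒢 𝒳 𝒵 𝒯 𝒴 → ℝ) :
    ∑ d, f d = ∑ g, ∑ x, ∑ z, ∑ t, ∑ t', ∑ y, ∑ y', f ⟨g, x, z, t, t', y, y'⟩ := by
  let e : Tup 𝒢 𝒳 𝒵 𝒯 𝒴 ≃ 𝒢 × 𝒳 × 𝒵 × 𝒯 × 𝒯 × 𝒴 × 𝒴 :=
    { toFun := fun d => (d.g, d.x, d.z, d.t, d.t', d.y, d.y')
      invFun := fun p => ⟨p.1, p.2.1, p.2.2.1, p.2.2.2.1, p.2.2.2.2.1, p.2.2.2.2.2.1, p.2.2.2.2.2.2⟩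
      left_inv := fun _ => rfl
      right_inv := fun _ => rfl }
  rw [← Equiv.sum_comp e.symm f]
  simp only [Fintype.sum_prod_type]
  rfl

/-- Given the factual outcome `Y`, graph `G`, covariates `X` and factual treatment `T`,
the latent `Z` is conditionally independent of the counterfactual treatment `T'`:
`p(z | y, g, x, t, t') = p(z | y, g, x, t)`. -/
theorem latent_condIndep_counterfactual_treatment
    {𝒢 𝒳 𝒵 𝒯 𝒴 : Type*} [Fintype 𝒢] [Fintype 𝒳] [Fintype 𝒵] [Fintype 𝒯] [Fintype 𝒴]
    [Nonempty 𝒢] [Nonempty 𝒳] [Nonempty 𝒵] [Nonempty 𝒯] [Nonempty 𝒴]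
    (pG : 𝒢 → ℝ) (pX : 𝒳 → ℝ) (pT pT' : 𝒯 → 𝒳 → ℝ)
    (pZ : 𝒵 → 𝒢 → 𝒳 → ℝ) (pO : 𝒴 → 𝒵 → 𝒯 → ℝ)
    (p : Tup 𝒢 𝒳 𝒵 𝒯 𝒴 → ℝ)
    (hp : ∀ d, p d = joint pG pX pT pT' pZ pO d)
    (hpG0 : ∀ g, 0 ≤ pG g) (hpG1 : ∑ g, pG g = 1)
    (hpX0 : ∀ x, 0 ≤ pX x) (hpX1 : ∑ x, pX x = 1)
    (hpT0 : ∀ t x, 0 ≤ pT t x) (hpT1 : ∀ x, ∑ t, pT t x = 1)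
    (hpT'0 : ∀ t x, 0 ≤ pT' t x) (hpT'1 : ∀ x, ∑ t, pT' t x = 1)
    (hpZ0 : ∀ z g x, 0 ≤ pZ z g x) (hpZ1 : ∀ g x, ∑ z, pZ z g x = 1)
    (hpO0 : ∀ y z t, 0 ≤ pO y z t) (hpO1 : ∀ z t, ∑ y, pO y z t = 1)
    (hpos : ∀ d, 0 < p d)
    (z : 𝒵) (y : 𝒴) (g : 𝒢) (x : 𝒳) (t t' : 𝒯) :
    condPr p {d | d.z = z} {d | d.y = y ∧ d.g = g ∧ d.x = x ∧ d.t = t ∧ d.t' = t'}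
      = condPr p {d | d.z = z} {d | d.y = y ∧ d.g = g ∧ d.x = x ∧ d.t = t} := by
  classical
  have key : ∀ (S : Set 𝒵) (U : Set 𝒯),
      Pr p {d | d.z ∈ S ∧ d.y = y ∧ d.g = g ∧ d.x = x ∧ d.t = t ∧ d.t' ∈ U}
        = (pG g * pX x * pT t x) * (∑ s, if s ∈ U then pT' s x else 0) *
          ∑ w, if w ∈ S then pZ w g x * pO y w t else 0 := by
    intro S U
    unfold Pr
    rw [sum_Tup]
    simp only [Set.indicator_apply, Set.mem_setOf_eq, hp, joint]
    rw [Finset.sum_eq_single g (by intro b _ hb; simp [hb]) (by simp),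
      Finset.sum_eq_single x (by intro b _ hb; simp [hb]) (by simp), Finset.mul_sum]
    refine Finset.sum_congr rfl fun w _ => ?_
    rw [Finset.sum_eq_single t (by intro b _ hb; simp [hb]) (by simp), Finset.mul_sum,
      Finset.sum_mul]
    refine Finset.sum_congr rfl fun s _ => ?_
    rw [Finset.sum_eq_single y (by intro b _ hb; simp [hb]) (by simp)]
    by_cases hw : w ∈ S <;> by_cases hs : s ∈ U <;> simp [hw, hs]
    rw [← Finset.mul_sum, hpO1]
    ring
  have h1 := key {z} {t'}
  have h2 := key Set.univ {t'}
  have h3 := key {z} Set.univ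
  have h4 := key Set.univ Set.univ
  simp only [Set.mem_singleton_iff, Set.mem_univ, true_and, and_true, if_true, hpT'1,
    Finset.sum_ite_eq', Finset.mem_univ, Finset.sum_ite_eq, mul_one] at h1 h2 h3 h4
  have hne : pT' t' x ≠ 0 := by
    intro h
    have := hpos ⟨g, x, z, t, t', y, y⟩
    simp [hp, joint, h] at this
  unfold condPr
  simp only [← Set.setOf_and]
  rw [h1, h2, h3, h4]
  rw [mul_right_comm _ (pT' t' x), mul_right_comm _ (pT' t' x), mul_div_mul_right _ _ hne]
end

section
/- For all values y', y, g, x, t, t' (with the conditioning events having positive probability), the counterfactual outcome admits the mixture representation p(y' | y, g, x, t, t') = Σ_z p(z | y, g, x, t) · p_O(y' | z, t'); that is, the conditional pmf of Y' given (Y, G, X, T, T') is the mixture over the posterior of Z given (Y, G, X, T) of the outcome kernel evaluated at the counterfactual treatment t'. -/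
theorem Pr_tup {𝒢 𝒳 𝒵 𝒯 𝒴 : Type*} [Fintype 𝒢] [Fintype 𝒳] [Fintype 𝒵] [Fintype 𝒯] [Fintype 𝒴]
    (p : Tup 𝒢 𝒳 𝒵 𝒯 𝒴 → ℝ) (E : Set (Tup 𝒢 𝒳 𝒵 𝒯 𝒴)) :
    Pr p E = ∑ g, ∑ x, ∑ z, ∑ t, ∑ t', ∑ y, ∑ y', E.indicator p ⟨g, x, z, t, t', y, y'⟩ := by
  unfold Pr
  rw [← Equiv.sum_comp
    ({ toFun := fun p => ⟨p.1, p.2.1, p.2.2.1, p.2.2.2.1, p.2.2.2.2.1, p.2.2.2.2.2.1, p.2.2.2.2.2.2⟩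
       invFun := fun d => (d.g, d.x, d.z, d.t, d.t', d.y, d.y')
       left_inv := fun _ => rfl
       right_inv := fun _ => rfl } : (𝒢 × 𝒳 × 𝒵 × 𝒯 × 𝒯 × 𝒴 × 𝒴) ≃ Tup 𝒢 𝒳 𝒵 𝒯 𝒴)]
  simp only [Fintype.sum_prod_type]
  rfl

theorem sum_ite_zero_irrel {ι : Type*} [Fintype ι] (c : Prop) [Decidable c] (f : ι → ℝ) :
    (∑ i, if c then f i else 0) = if c then ∑ i, f i else 0 := by
  split_ifs <;> simp

/-- Mixture representation of the counterfactual outcome: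
`p(y' | y, g, x, t, t') = Σ_z p(z | y, g, x, t) · p_O(y' | z, t')`. -/
theorem counterfactual_mixture_representation
    {𝒢 𝒳 𝒵 𝒯 𝒴 : Type*} [Fintype 𝒢] [Fintype 𝒳] [Fintype 𝒵] [Fintype 𝒯] [Fintype 𝒴]
    [Nonempty 𝒢] [Nonempty 𝒳] [Nonempty 𝒵] [Nonempty 𝒯] [Nonempty 𝒴]
    (pG : 𝒢 → ℝ) (pX : 𝒳 → ℝ) (pT pT' : 𝒯 → 𝒳 → ℝ)
    (pZ : 𝒵 → 𝒢 → 𝒳 → ℝ) (pO : 𝒴 → 𝒵 → 𝒯 → ℝ)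
    (p : Tup 𝒢 𝒳 𝒵 𝒯 𝒴 → ℝ)
    (hp : ∀ d, p d = joint pG pX pT pT' pZ pO d)
    (hpG0 : ∀ g, 0 ≤ pG g) (hpG1 : ∑ g, pG g = 1)
    (hpX0 : ∀ x, 0 ≤ pX x) (hpX1 : ∑ x, pX x = 1)
    (hpT0 : ∀ t x, 0 ≤ pT t x) (hpT1 : ∀ x, ∑ t, pT t x = 1)
    (hpT'0 : ∀ t x, 0 ≤ pT' t x) (hpT'1 : ∀ x, ∑ t, pT' t x = 1)
    (hpZ0 : ∀ z g x, 0 ≤ pZ z g x) (hpZ1 : ∀ g x, ∑ z, pZ z g x = 1)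
    (hpO0 : ∀ y z t, 0 ≤ pO y z t) (hpO1 : ∀ z t, ∑ y, pO y z t = 1)
    (hpos : ∀ d, 0 < p d)
    (y' : 𝒴) (y : 𝒴) (g : 𝒢) (x : 𝒳) (t t' : 𝒯) :
    condPr p {d | d.y' = y'} {d | d.y = y ∧ d.g = g ∧ d.x = x ∧ d.t = t ∧ d.t' = t'}
      = ∑ z, condPr p {d | d.z = z} {d | d.y = y ∧ d.g = g ∧ d.x = x ∧ d.t = t}
          * pO y' z t' := by
  classical
  have h1 : Pr p ({d | d.y' = y'} ∩ {d | d.y = y ∧ d.g = g ∧ d.x = x ∧ d.t = t ∧ d.t' = t'})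
      = ∑ z, p ⟨g, x, z, t, t', y, y'⟩ := by
    rw [Pr_tup]
    simp only [Set.indicator_apply, Set.mem_inter_iff, Set.mem_setOf_eq, ite_and,
      sum_ite_zero_irrel, Finset.sum_ite_eq', Finset.mem_univ, if_true]
  have h2 : Pr p {d | d.y = y ∧ d.g = g ∧ d.x = x ∧ d.t = t ∧ d.t' = t'}
      = ∑ z, ∑ w, p ⟨g, x, z, t, t', y, w⟩ := by
    rw [Pr_tup]
    simp only [Set.indicator_apply, Set.mem_inter_iff, Set.mem_setOf_eq, ite_and,
      sum_ite_zero_irrel, Finset.sum_ite_eq', Finset.mem_univ, if_true]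
  have h3 : ∀ z, Pr p ({d | d.z = z} ∩ {d | d.y = y ∧ d.g = g ∧ d.x = x ∧ d.t = t})
      = ∑ s, ∑ w, p ⟨g, x, z, t, s, y, w⟩ := by
    intro z
    rw [Pr_tup]
    simp only [Set.indicator_apply, Set.mem_inter_iff, Set.mem_setOf_eq, ite_and,
      sum_ite_zero_irrel, Finset.sum_ite_eq', Finset.mem_univ, if_true]
  have h4 : Pr p {d | d.y = y ∧ d.g = g ∧ d.x = x ∧ d.t = t}
      = ∑ z, ∑ s, ∑ w, p ⟨g, x, z, t, s, y, w⟩ := by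
    rw [Pr_tup]
    simp only [Set.indicator_apply, Set.mem_inter_iff, Set.mem_setOf_eq, ite_and,
      sum_ite_zero_irrel, Finset.sum_ite_eq', Finset.mem_univ, if_true]
  have hC : pG g * pX x * pT t x * pT' t' x ≠ 0 := by
    obtain ⟨z⟩ := ‹Nonempty 𝒵›
    have := hpos ⟨g, x, z, t, t', y, y'⟩
    rw [hp] at this
    intro h
    simp [joint, h] at this
  have hC1 : pG g * pX x * pT t x ≠ 0 := left_ne_zero_of_mul hC
  have k : ∀ z s, ∑ w, p ⟨g, x, z, t, s, y, w⟩
      = pG g * pX x * pT t x * pT' s x * (pZ z g x * pO y z t) := by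
    intro z s
    simp only [hp, joint, ← Finset.mul_sum, hpO1]
    ring
  have k3 : ∀ z, ∑ s, ∑ w, p ⟨g, x, z, t, s, y, w⟩
      = pG g * pX x * pT t x * (pZ z g x * pO y z t) := by
    intro z
    simp only [k, ← Finset.sum_mul, ← Finset.mul_sum, hpT'1, mul_one]
  have k1 : ∀ z, p ⟨g, x, z, t, t', y, y'⟩
      = pG g * pX x * pT t x * pT' t' x * (pZ z g x * pO y z t * pO y' z t') := by
    intro z
    simp only [hp, joint]
    ring
  unfold condPr
  simp only [h1, h2, h3, h4, k3]
  simp only [k, k1, ← Finset.mul_sum]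
  rw [mul_div_mul_left _ _ hC, Finset.sum_div]
  refine Finset.sum_congr rfl fun z _ => ?_
  rw [mul_div_mul_left _ _ hC1]
  ring
end

section
/- Score representation of the derivative of a conditional probability along a parametric submodel: let D be a nonempty finite type, p a strictly positive pmf on D, and S : D → ℝ a score with Σ_d p(d) S(d) = 0; let A : D → α and B : D → β be functions into arbitrary types, and fix values a' ∈ α and b ∈ β with p(A = a', B = b) > 0. Then the map ε ↦ p_ε(A = a' | B = b), where p_ε(d) = p(d)(1 + ε S(d)) and p_ε(A = a' | B = b) = p_ε(A = a', B = b) / p_ε(B = b), is differentiable at ε = 0 with derivative p(A = a' | B = b) · ( E_p[S | A = a', B = b] − E_p[S | B = b] ), where E_p[S | E] denotes the conditional expectation Σ_{d ∈ E} p(d) S(d) / Σ_{d ∈ E} p(d). -/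
/-- Conditional expectation `E_p[S | E] = Σ_{d ∈ E} p(d) S(d) / Σ_{d ∈ E} p(d)`. -/
noncomputable def condExp {D : Type*} [Fintype D] (p : D → ℝ) (S : D → ℝ) (E : Set D) : ℝ :=
  (∑ d, E.indicator (fun d => p d * S d) d) / Pr p E

theorem Pr_submodel_affine {D : Type*} [Fintype D] (p S : D → ℝ) (E : Set D) (ε : ℝ) :
    Pr (fun d => p d * (1 + ε * S d)) E
      = Pr p E + ε * ∑ d, E.indicator (fun d => p d * S d) d := by
  classical
  unfold Pr
  rw [Finset.mul_sum, ← Finset.sum_add_distrib]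
  refine Finset.sum_congr rfl fun d _ => ?_
  by_cases h : d ∈ E
  · simp only [Set.indicator_of_mem h]
    ring
  · simp [Set.indicator_of_notMem h]

theorem hasDerivAt_affine_eps (a c : ℝ) : HasDerivAt (fun ε : ℝ => a + ε * c) c 0 := by
  simpa using ((hasDerivAt_id (0 : ℝ)).mul_const c).const_add a

/-- Score representation of the derivative of a conditional probability along a parametric
submodel: `ε ↦ p_ε(A = a' | B = b)` with `p_ε(d) = p(d)(1 + ε S(d))` is differentiable at
`ε = 0` with derivative `p(A = a' | B = b) · (E_p[S | A = a', B = b] - E_p[S | B = b])`. -/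
theorem score_representation_of_conditional_probability_derivative
    {D : Type*} [Fintype D] [Nonempty D] {α β : Type*}
    (p : D → ℝ) (hpos : ∀ d, 0 < p d) (hsum : ∑ d, p d = 1)
    (S : D → ℝ) (hS : ∑ d, p d * S d = 0)
    (A : D → α) (B : D → β) (a' : α) (b : β)
    (hAB : 0 < Pr p {d | A d = a' ∧ B d = b}) :
    HasDerivAt (fun ε : ℝ =>
        Pr (fun d => p d * (1 + ε * S d)) {d | A d = a' ∧ B d = b}
          / Pr (fun d => p d * (1 + ε * S d)) {d | B d = b})
      (Pr p {d | A d = a' ∧ B d = b} / Pr p {d | B d = b}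
        * (condExp p S {d | A d = a' ∧ B d = b} - condExp p S {d | B d = b})) 0 := by
  have hB : 0 < Pr p {d | B d = b} := by
    refine lt_of_lt_of_le hAB (Finset.sum_le_sum fun d _ => ?_)
    exact Set.indicator_le_indicator_of_subset (fun x hx => hx.2) (fun x => (hpos x).le) d
  simp only [Pr_submodel_affine, condExp]
  generalize Pr p {d | A d = a' ∧ B d = b} = x at *
  generalize Pr p {d | B d = b} = y at *
  have h := (hasDerivAt_affine_eps x
    (∑ d, {d | A d = a' ∧ B d = b}.indicator (fun d => p d * S d) d)).div
    (hasDerivAt_affine_eps y (∑ d, {d | B d = b}.indicator (fun d => p d * S d) d))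
    (by simpa using hB.ne')
  refine h.congr_deriv ?_
  have h1 := hB.ne'
  have h2 := hAB.ne'
  simp only [zero_mul, add_zero]
  field_simp
end
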